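/- arXiv:1708.06804 — 2 statements merged into one kernel-verified Lean document; each statement's English description precedes it below -/
import Mathlib

section
/- Let n ≥ 2 and let B be an open ball in ℝⁿ. There exists a constant C = C(B) such that for every C¹ function u: B → ℝ whose gradient is Lebesgue integrable on B and whose support intersected with B has Lebesgue measure at most half the measure of B, one has ∫_B |u|^{n/(n−1)} dx ≤ C·( ∫_B |∇u| dx )^{n/(n−1)}. -/
open MeasureTheory Real

lemma aux_affine {n : ℕ} (G : EuclideanSpace ℝ (Fin n) → ENNReal) (hG : Measurable G)
    (y : EuclideanSpace ℝ (Fin n)) (c : ℝ) (hc : 0 < c) :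
    ∫⁻ z, G (y + c • z) = ENNReal.ofReal (c ^ (-(n : ℝ))) * ∫⁻ z, G z := by
  have h1 : ∫⁻ z, G (y + c • z) = ∫⁻ z, G (y + z) ∂(Measure.map (c • ·) volume) := by
    rw [lintegral_map (by fun_prop) (by fun_prop)]
  rw [h1, Measure.map_addHaar_smul _ hc.ne', lintegral_smul_measure,
    lintegral_add_left_eq_self]
  simp only [finrank_euclideanSpace, Fintype.card_fin, smul_eq_mul]
  rw [abs_of_pos (by positivity), Real.rpow_neg hc.le, Real.rpow_natCast]

lemma aux_kernel {n : ℕ} (hn : 2 ≤ n) (a b : ℝ) (ha : 0 < a) (hab : a ≤ b) (L : ENNReal)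
    (I : ℝ → ENNReal)
    (h1 : ∀ t, 0 < t → t ≤ 1 / 2 → I t ≤ ENNReal.ofReal (2 ^ n * b) * L)
    (h2 : ∀ t, 0 < t → t < 1 → I t ≤ ENNReal.ofReal (a * t ^ (-(n : ℝ))) * L) :
    ∫⁻ t in Set.Ioo 0 1, I t
      ≤ ENNReal.ofReal (2 ^ n * b ^ (1 - 1 / (n : ℝ)) * a ^ (1 / (n : ℝ))) * L := by
  have hb : 0 < b := ha.trans_le hab
  have hn' : (2 : ℝ) ≤ n := by exact_mod_cast hn
  set q : ℝ := (a / b) ^ (1 / (n : ℝ)) with hq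
  have hq0 : 0 < q := by positivity
  have hq1 : q ≤ 1 := Real.rpow_le_one (by positivity) ((div_le_one hb).2 hab) (by positivity)
  have hqn : q ^ (n : ℝ) = a / b := by
    rw [hq, ← Real.rpow_mul (by positivity), one_div_mul_cancel (by positivity), Real.rpow_one]
  set s : ℝ := q / 2 with hs
  have hs0 : 0 < s := by positivity
  have hs1 : s ≤ 1 / 2 := by linarith
  have hsub : Set.Ioo (0 : ℝ) 1 ⊆ Set.Ioc 0 s ∪ Set.Ioo s 1 := by
    intro t ht
    rcases le_or_gt t s with h | h
    · exact Or.inl ⟨ht.1, h⟩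
    · exact Or.inr ⟨h, ht.2⟩
  have hbq : b * q = b ^ (1 - 1 / (n : ℝ)) * a ^ (1 / (n : ℝ)) := by
    rw [hq, Real.div_rpow ha.le hb.le, Real.rpow_sub hb, Real.rpow_one]
    field_simp
  have e1 : ∫⁻ t in Set.Ioc 0 s, I t ≤ ENNReal.ofReal (2 ^ n * b * s) * L := by
    calc ∫⁻ t in Set.Ioc 0 s, I t ≤ ∫⁻ t in Set.Ioc 0 s, ENNReal.ofReal (2 ^ n * b) * L :=
          setLIntegral_mono' measurableSet_Ioc fun t ht => h1 t ht.1 (ht.2.trans hs1)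
      _ = _ := by
          rw [setLIntegral_const, Real.volume_Ioc, sub_zero, mul_right_comm,
            ← ENNReal.ofReal_mul (by positivity)]
  have e2 : ∫⁻ t in Set.Ioo s 1, I t ≤ ENNReal.ofReal (2 ^ n * b * s) * L := by
    calc ∫⁻ t in Set.Ioo s 1, I t
        ≤ ∫⁻ t in Set.Ioo s 1, ENNReal.ofReal (a * t ^ (-(n : ℝ))) * L :=
          setLIntegral_mono' measurableSet_Ioo fun t ht => h2 t (hs0.trans ht.1) ht.2
      _ ≤ ∫⁻ t in Set.Ioi s, ENNReal.ofReal (a * t ^ (-(n : ℝ))) * L :=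
          lintegral_mono_set Set.Ioo_subset_Ioi_self
      _ = (∫⁻ t in Set.Ioi s, ENNReal.ofReal (a * t ^ (-(n : ℝ)))) * L := by
          rw [lintegral_mul_const _ (by fun_prop)]
      _ = ENNReal.ofReal (∫ t in Set.Ioi s, (a * t ^ (-(n : ℝ)))) * L := by
          rw [ofReal_integral_eq_lintegral_ofReal]
          · exact (integrableOn_Ioi_rpow_of_lt (by linarith) hs0).const_mul a
          · refine (ae_restrict_iff' measurableSet_Ioi).2 (Filter.Eventually.of_forall ?_)
            intro t ht
            have : 0 < t := hs0.trans ht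
            show 0 ≤ a * t ^ (-(n : ℝ))
            positivity
      _ ≤ _ := by
          gcongr
          rw [integral_const_mul, integral_Ioi_rpow_of_lt (by linarith) hs0]
          have hsn : s ^ (-(n : ℝ) + 1) = 2 ^ n * (b / a) * s := by
            rw [Real.rpow_add hs0, Real.rpow_one, Real.rpow_neg hs0.le, hs,
              Real.div_rpow hq0.le (by norm_num), hqn, Real.rpow_natCast]
            field_simp
          rw [hsn]
          have : a * (-(2 ^ n * (b / a) * s) / (-(n : ℝ) + 1)) = 2 ^ n * b * s * (1 / ((n : ℝ) - 1)) := by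
            have : (n : ℝ) - 1 ≠ 0 := by linarith
            have : -(n : ℝ) + 1 ≠ 0 := by intro h; apply this; linarith
            field_simp
            ring
          rw [this]
          apply mul_le_of_le_one_right (by positivity)
          rw [div_le_one (by linarith)]
          linarith
  calc ∫⁻ t in Set.Ioo 0 1, I t ≤ ∫⁻ t in Set.Ioc 0 s ∪ Set.Ioo s 1, I t := lintegral_mono_set hsub
    _ ≤ _ := lintegral_union_le _ _ _
    _ ≤ _ := add_le_add e1 e2
    _ = _ := by
      rw [← add_mul, ← ENNReal.ofReal_add (by positivity) (by positivity)]
      congr 2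
      rw [mul_assoc (2 ^ n) (b ^ _), ← hbq, hs]; ring

lemma aux_triple {n : ℕ} (hn : 2 ≤ n) (G : EuclideanSpace ℝ (Fin n) → ENNReal)
    (hG : Measurable G) (S B : Set (EuclideanSpace ℝ (Fin n))) (a b : ℝ) (ha : 0 < a)
    (hab : a ≤ b) (hSa : volume S = ENNReal.ofReal a) (hBb : volume B = ENNReal.ofReal b) :
    ∫⁻ x in S, ∫⁻ z in B, ∫⁻ t in Set.Ioo (0 : ℝ) 1, G (x + t • (z - x))
      ≤ ENNReal.ofReal (2 ^ n * b ^ (1 - 1 / (n : ℝ)) * a ^ (1 / (n : ℝ))) * ∫⁻ y, G y := by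
  have hm : Measurable (fun p : (EuclideanSpace ℝ (Fin n) × EuclideanSpace ℝ (Fin n)) × ℝ =>
      G (p.1.1 + p.2 • (p.1.2 - p.1.1))) := hG.comp (by fun_prop)
  have e1 : ∀ x, ∫⁻ z in B, ∫⁻ t in Set.Ioo (0 : ℝ) 1, G (x + t • (z - x))
      = ∫⁻ t in Set.Ioo (0 : ℝ) 1, ∫⁻ z in B, G (x + t • (z - x)) := by
    intro x
    refine lintegral_lintegral_swap (Measurable.aemeasurable ?_)
    exact hG.comp (by fun_prop)
  simp_rw [e1]
  rw [lintegral_lintegral_swap]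
  swap
  · refine Measurable.aemeasurable ?_
    have : Measurable (fun p : (EuclideanSpace ℝ (Fin n) × ℝ) × EuclideanSpace ℝ (Fin n) =>
      G (p.1.1 + p.1.2 • (p.2 - p.1.1))) := hG.comp (by fun_prop)
    exact this.lintegral_prod_right'
  refine aux_kernel hn a b ha hab _ _ ?_ ?_
  · intro t ht ht2
    rw [lintegral_lintegral_swap]
    swap
    · refine Measurable.aemeasurable ?_
      exact hG.comp (by fun_prop)
    have : ∀ z, ∫⁻ x in S, G (x + t • (z - x)) ≤ ENNReal.ofReal (2 ^ n) * ∫⁻ y, G y := by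
      intro z
      calc ∫⁻ x in S, G (x + t • (z - x)) ≤ ∫⁻ x, G (x + t • (z - x)) :=
            setLIntegral_le_lintegral _ _
        _ = ∫⁻ x, G (t • z + (1 - t) • x) := by
            congr 1; ext x; congr 1; module
        _ = _ := aux_affine G hG _ _ (by linarith)
        _ ≤ _ := by
            gcongr
            rw [Real.rpow_neg (by linarith), Real.rpow_natCast, ← inv_pow]
            gcongr
            · exact inv_nonneg.2 (by linarith)
            · rw [inv_le_comm₀ (by linarith) (by norm_num)]; linarith
    calc _ ≤ ∫⁻ z in B, ENNReal.ofReal (2 ^ n) * ∫⁻ y, G y := lintegral_mono fun z => this z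
      _ = _ := by
        rw [setLIntegral_const, hBb, mul_right_comm, ← ENNReal.ofReal_mul (by positivity)]
  · intro t ht ht2
    have : ∀ x, ∫⁻ z in B, G (x + t • (z - x)) ≤ ENNReal.ofReal (t ^ (-(n : ℝ))) * ∫⁻ y, G y := by
      intro x
      calc ∫⁻ z in B, G (x + t • (z - x)) ≤ ∫⁻ z, G (x + t • (z - x)) :=
            setLIntegral_le_lintegral _ _
        _ = ∫⁻ z, G ((x - t • x) + t • z) := by
            congr 1; ext z; congr 1; module
        _ ≤ _ := (aux_affine G hG _ _ ht).le
    calc _ ≤ ∫⁻ z in S, ENNReal.ofReal (t ^ (-(n : ℝ))) * ∫⁻ y, G y :=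
          lintegral_mono fun z => this z
      _ = _ := by
        rw [setLIntegral_const, hSa, mul_right_comm, ← ENNReal.ofReal_mul (by positivity), mul_comm a]

lemma aux_segment {n : ℕ} (x₀ : EuclideanSpace ℝ (Fin n)) (r : ℝ) 
    (v : EuclideanSpace ℝ (Fin n) → ℝ) (hv : ContDiffOn ℝ 1 v (Metric.ball x₀ r))
    (x z : EuclideanSpace ℝ (Fin n)) (hx : x ∈ Metric.ball x₀ r) (hz : z ∈ Metric.ball x₀ r) :
    ‖v z - v x‖ₑ ≤ ∫⁻ t in Set.Ioo (0 : ℝ) 1, ENNReal.ofReal (2 * r) *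
      (Metric.ball x₀ r).indicator (fun y => ‖fderiv ℝ v y‖ₑ) (x + t • (z - x)) := by
  have hmem : ∀ t ∈ Set.Icc (0 : ℝ) 1, x + t • (z - x) ∈ Metric.ball x₀ r := fun t ht =>
    (convex_ball x₀ r).add_smul_sub_mem hx hz ht
  have hc : ContDiffOn ℝ 1 (fun t : ℝ => v (x + t • (z - x))) (Set.Icc 0 1) :=
    hv.comp (t := Metric.ball x₀ r) (f := fun t : ℝ => x + t • (z - x)) (by fun_prop) hmem
  have := enorm_sub_le_lintegral_deriv_of_contDiffOn_Icc hc zero_le_one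
  simp only [one_smul, add_sub_cancel, zero_smul, add_zero] at this
  rw [← restrict_Ioo_eq_restrict_Icc] at this
  refine this.trans (setLIntegral_mono' measurableSet_Ioo fun t ht => ?_)
  have hm := hmem t ⟨ht.1.le, ht.2.le⟩
  rw [Set.indicator_of_mem hm]
  have hd : HasFDerivAt v (fderiv ℝ v (x + t • (z - x))) (x + t • (z - x)) :=
    ((hv.contDiffAt (Metric.isOpen_ball.mem_nhds hm)).differentiableAt (by norm_num)).hasFDerivAt
  have hl : HasDerivAt (fun t : ℝ => x + t • (z - x)) (z - x) t := by
    simpa using ((hasDerivAt_id t).smul_const (z - x)).const_add x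
  have hdd := hd.comp_hasDerivAt t hl
  have : deriv (fun t : ℝ => v (x + t • (z - x))) t = fderiv ℝ v (x + t • (z - x)) (z - x) :=
    hdd.deriv
  rw [this, ← ofReal_norm, ← ofReal_norm, ← ENNReal.ofReal_mul (by
    have := Metric.pos_of_mem_ball hx; positivity)]
  apply ENNReal.ofReal_le_ofReal
  refine (ContinuousLinearMap.le_opNorm _ _).trans ?_
  rw [mul_comm]
  gcongr
  rw [← dist_eq_norm]
  have h1 := Metric.mem_ball.1 hx
  have h2 := Metric.mem_ball.1 hz
  have := dist_triangle_right z x x₀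
  linarith

lemma aux_weak {n : ℕ} (hn : 2 ≤ n) (x₀ : EuclideanSpace ℝ (Fin n)) (r : ℝ) (hr : 0 < r) :
    ∃ C > 0, ∀ v : EuclideanSpace ℝ (Fin n) → ℝ,
      ContDiffOn ℝ 1 v (Metric.ball x₀ r) →
      volume (Function.support v ∩ Metric.ball x₀ r) * 2 ≤ volume (Metric.ball x₀ r) →
      volume (Metric.ball x₀ r ∩ {x | 1 ≤ |v x|}) ≤
        (ENNReal.ofReal C * ∫⁻ x in Metric.ball x₀ r, ‖fderiv ℝ v x‖ₑ)
          ^ ((n : ℝ) / ((n : ℝ) - 1)) := by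
  have hn' : (2 : ℝ) ≤ n := by exact_mod_cast hn
  set B := Metric.ball x₀ r with hB
  have hBfin : volume B ≠ ⊤ := measure_ball_lt_top.ne
  obtain ⟨b, hbdef⟩ : ∃ b : ℝ, b = (volume B).toReal := ⟨_, rfl⟩
  have hb : 0 < b := by
    rw [hbdef]; exact ENNReal.toReal_pos (Metric.measure_ball_pos _ _ hr).ne' hBfin
  have hBb : volume B = ENNReal.ofReal b := by rw [hbdef, ENNReal.ofReal_toReal hBfin]
  refine ⟨4 * r * 2 ^ n * b ^ (-(1 / (n : ℝ))), by positivity, ?_⟩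
  intro v hv hsupp
  set C := 4 * r * 2 ^ n * b ^ (-(1 / (n : ℝ))) with hC
  have hC0 : 0 < C := by positivity
  set S := B ∩ {x | 1 ≤ |v x|} with hS
  have hp : 0 < (n : ℝ) / ((n : ℝ) - 1) := div_pos (by linarith) (by linarith)
  rcases eq_or_ne (volume S) 0 with h0 | h0
  · rw [h0]; exact zero_le
  have hSfin : volume S ≠ ⊤ := measure_ne_top_of_subset Set.inter_subset_left hBfin
  obtain ⟨a, hadef⟩ : ∃ a : ℝ, a = (volume S).toReal := ⟨_, rfl⟩
  have ha : 0 < a := by rw [hadef]; exact ENNReal.toReal_pos h0 hSfin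
  have hSa : volume S = ENNReal.ofReal a := by rw [hadef, ENNReal.ofReal_toReal hSfin]
  have hab : a ≤ b := by
    rw [hadef, hbdef]; exact ENNReal.toReal_mono hBfin (measure_mono Set.inter_subset_left)
  set L := ∫⁻ x in B, ‖fderiv ℝ v x‖ₑ with hL
  rcases eq_or_ne L ⊤ with hLt | hLt
  · rw [hLt, ENNReal.mul_top (by simpa using hC0), ENNReal.top_rpow_of_pos hp]; exact le_top
  have hvc : ContinuousOn v B := hv.continuousOn
  have hSm : MeasurableSet S := by
    have : IsOpen (B ∩ v ⁻¹' {s | |s| < 1}) :=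
      hvc.isOpen_inter_preimage Metric.isOpen_ball (isOpen_lt (by fun_prop) (by fun_prop))
    have h2 : S = B \ (B ∩ v ⁻¹' {s | |s| < 1}) := by
      ext x; simp only [hS, Set.mem_inter_iff, Set.mem_ofPred_eq, Set.mem_sdiff, Set.mem_preimage]
      constructor
      · rintro ⟨h1, h2⟩; exact ⟨h1, fun h => absurd h.2 (not_lt.2 h2)⟩
      · rintro ⟨h1, h2⟩; exact ⟨h1, not_lt.1 fun h => h2 ⟨h1, h⟩⟩
    rw [h2]; exact measurableSet_ball.diff this.measurableSet
  have hTm : MeasurableSet (Function.support v ∩ B) := by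
    have : IsOpen (B ∩ v ⁻¹' {0}ᶜ) :=
      hvc.isOpen_inter_preimage Metric.isOpen_ball isOpen_compl_singleton
    rw [Set.inter_comm]; exact this.measurableSet
  set Z := B \ (Function.support v ∩ B) with hZ
  have hZm : MeasurableSet Z := measurableSet_ball.diff hTm
  have hZvol : ENNReal.ofReal (b / 2) ≤ volume Z := by
    have hT : volume (Function.support v ∩ B) ≤ ENNReal.ofReal (b / 2) := by
      rw [hBb] at hsupp
      have : ENNReal.ofReal b = ENNReal.ofReal (b / 2) * 2 := by
        rw [show (2 : ENNReal) = ENNReal.ofReal 2 by simp, ← ENNReal.ofReal_mul (by positivity)]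
        congr 1; ring
      rw [this] at hsupp
      exact (ENNReal.mul_le_mul_iff_left (by simp) (by simp)).1 hsupp
    rw [hZ, measure_sdiff Set.inter_subset_right hTm.nullMeasurableSet
      (measure_ne_top_of_subset Set.inter_subset_right hBfin), hBb]
    calc ENNReal.ofReal (b / 2) = ENNReal.ofReal b - ENNReal.ofReal (b / 2) := by
          rw [← ENNReal.ofReal_sub _ (by positivity)]; congr 1; ring
      _ ≤ _ := tsub_le_tsub_left hT _
  set G := B.indicator (fun y => ‖fderiv ℝ v y‖ₑ) with hG
  have hGm : Measurable G := ((measurable_fderiv ℝ v).enorm).indicator measurableSet_ball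
  have hGL : ∫⁻ y, G y = L := by rw [hG, lintegral_indicator measurableSet_ball]
  have key : ENNReal.ofReal a * ENNReal.ofReal (b / 2) ≤ ENNReal.ofReal (2 * r) *
      (ENNReal.ofReal (2 ^ n * b ^ (1 - 1 / (n : ℝ)) * a ^ (1 / (n : ℝ))) * L) := by
    calc ENNReal.ofReal a * ENNReal.ofReal (b / 2) ≤ volume S * volume Z := by
          rw [hSa]; gcongr
      _ = ∫⁻ x in S, ∫⁻ z in Z, 1 := by simp [mul_comm]
      _ ≤ ∫⁻ x in S, ∫⁻ z in Z, ∫⁻ t in Set.Ioo (0 : ℝ) 1,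
            ENNReal.ofReal (2 * r) * G (x + t • (z - x)) := by
          refine setLIntegral_mono' hSm fun x hx => setLIntegral_mono' hZm fun z hz => ?_
          refine le_trans ?_ (aux_segment x₀ r v hv x z hx.1 hz.1)
          have hvz : v z = 0 := by
            by_contra h; exact hz.2 ⟨h, hz.1⟩
          rw [hvz, zero_sub, enorm_neg, ← ofReal_norm, Real.norm_eq_abs]
          exact ENNReal.one_le_ofReal.2 hx.2
      _ ≤ ∫⁻ x in S, ∫⁻ z in B, ∫⁻ t in Set.Ioo (0 : ℝ) 1,
            ENNReal.ofReal (2 * r) * G (x + t • (z - x)) :=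
          lintegral_mono fun x => lintegral_mono_set Set.sdiff_subset
      _ = ENNReal.ofReal (2 * r) * ∫⁻ x in S, ∫⁻ z in B, ∫⁻ t in Set.Ioo (0 : ℝ) 1,
            G (x + t • (z - x)) := by
          simp_rw [lintegral_const_mul' _ _ ENNReal.ofReal_ne_top]
      _ ≤ _ := by
          rw [← hGL]
          gcongr
          exact aux_triple hn G hGm S B a b ha hab hSa hBb
  obtain ⟨l, hl⟩ : ∃ l : ℝ, l = L.toReal := ⟨_, rfl⟩
  have hl0 : 0 ≤ l := by rw [hl]; exact ENNReal.toReal_nonneg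
  have hLl : L = ENNReal.ofReal l := by rw [hl, ENNReal.ofReal_toReal hLt]
  rw [hLl, ← ENNReal.ofReal_mul ha.le, ← ENNReal.ofReal_mul (by positivity),
    ← ENNReal.ofReal_mul (by positivity), ENNReal.ofReal_le_ofReal_iff (by positivity)] at key
  rw [hLl, ← ENNReal.ofReal_mul hC0.le, ENNReal.ofReal_rpow_of_nonneg (by positivity) hp.le, hSa]
  apply ENNReal.ofReal_le_ofReal
  have h3 : a ^ (1 - 1 / (n : ℝ)) ≤ C * l := by
    have e1 : a = a ^ (1 - 1 / (n : ℝ)) * a ^ (1 / (n : ℝ)) := by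
      rw [← Real.rpow_add ha]; simp
    have e2 : b ^ (1 - 1 / (n : ℝ)) = b * b ^ (-(1 / (n : ℝ))) := by
      rw [sub_eq_add_neg, Real.rpow_add hb, Real.rpow_one]
    have hq : 0 < a ^ (1 / (n : ℝ)) * (b / 2) := by positivity
    refine le_of_mul_le_mul_right ?_ hq
    calc a ^ (1 - 1 / (n : ℝ)) * (a ^ (1 / (n : ℝ)) * (b / 2)) = a * (b / 2) := by
          rw [← mul_assoc, ← e1]
      _ ≤ _ := key
      _ = _ := by rw [e2, hC]; ring
  calc a = (a ^ (1 - 1 / (n : ℝ))) ^ ((n : ℝ) / ((n : ℝ) - 1)) := by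
        rw [← Real.rpow_mul ha.le]
        have : (n : ℝ) - 1 ≠ 0 := by linarith
        have : (1 - 1 / (n : ℝ)) * ((n : ℝ) / ((n : ℝ) - 1)) = 1 := by field_simp
        rw [this, Real.rpow_one]
    _ ≤ _ := Real.rpow_le_rpow (by positivity) h3 hp.le

lemma aux_cutoff : ∃ (φ : ℝ → ℝ) (M : ℝ), 0 < M ∧ ContDiff ℝ 1 φ ∧ (φ 0 = 0) ∧
    (∀ s, 2 ≤ |s| → φ s = 1) ∧ (∀ s, |deriv φ s| ≤ M) ∧
    (∀ s, ¬ (1 < |s| ∧ |s| < 2) → deriv φ s = 0) := by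
  set φ : ℝ → ℝ := fun s => Real.smoothTransition ((s ^ 2 - 1) / 3) with hφ
  have hc : ContDiff ℝ 1 φ :=
    (Real.smoothTransition.contDiff (n := 1)).comp (by fun_prop)
  have h1 : ∀ s, 2 ≤ |s| → φ s = 1 := by
    intro s hs
    refine Real.smoothTransition.one_of_one_le ?_
    have := sq_abs s
    nlinarith
  have h0 : ∀ s, |s| ≤ 1 → φ s = 0 := by
    intro s hs
    refine Real.smoothTransition.zero_of_nonpos ?_
    have := sq_abs s
    nlinarith [abs_nonneg s]
  have hd : ∀ s, ¬ (1 < |s| ∧ |s| < 2) → deriv φ s = 0 := by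
    intro s hs
    rcases le_or_gt |s| 1 with h | h
    · apply IsLocalMin.deriv_eq_zero
      refine Filter.Eventually.of_forall fun y => ?_
      rw [h0 s h]; exact Real.smoothTransition.nonneg _
    · have h2 : 2 ≤ |s| := not_lt.1 fun h' => hs ⟨h, h'⟩
      apply IsLocalMax.deriv_eq_zero
      refine Filter.Eventually.of_forall fun y => ?_
      rw [h1 s h2]; exact Real.smoothTransition.le_one _
  obtain ⟨M, hM⟩ := (isCompact_Icc (a := (-2 : ℝ)) (b := 2)).exists_bound_of_continuousOn
    (hc.continuous_deriv le_rfl).continuousOn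
  refine ⟨φ, max M 1, by positivity, hc, h0 0 (by simp), h1, fun s => ?_, hd⟩
  by_cases hs : 1 < |s| ∧ |s| < 2
  · exact (hM s (abs_le.1 hs.2.le)).trans (le_max_left _ _)
  · rw [hd s hs]; simp

lemma aux_tsum {ι : Type*} (x : ι → ENNReal) (p : ℝ) (hp : 1 ≤ p) :
    ∑' i, x i ^ p ≤ (∑' i, x i) ^ p := by
  have e : ∀ y : ENNReal, y ^ p = y * y ^ (p - 1) := by
    intro y
    conv_lhs => rw [show p = 1 + (p - 1) by ring]
    rw [ENNReal.rpow_add_of_nonneg _ _ (by norm_num) (by linarith), ENNReal.rpow_one]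
  calc ∑' i, x i ^ p ≤ ∑' i, x i * (∑' j, x j) ^ (p - 1) := by
        refine ENNReal.tsum_le_tsum fun i => ?_
        rw [e]
        exact mul_le_mul_right (ENNReal.rpow_le_rpow (ENNReal.le_tsum i) (by linarith)) _
    _ = _ := by rw [ENNReal.tsum_mul_right, ← e]

lemma aux_main {n : ℕ} (hn : 2 ≤ n) (x₀ : EuclideanSpace ℝ (Fin n)) (r : ℝ) (hr : 0 < r) :
    ∃ C > 0, ∀ u : EuclideanSpace ℝ (Fin n) → ℝ,
      ContDiffOn ℝ 1 u (Metric.ball x₀ r) →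
      volume (Function.support u ∩ Metric.ball x₀ r) * 2 ≤ volume (Metric.ball x₀ r) →
      ∫⁻ x in Metric.ball x₀ r, ENNReal.ofReal (|u x| ^ ((n : ℝ) / ((n : ℝ) - 1))) ≤
        (ENNReal.ofReal C * ∫⁻ x in Metric.ball x₀ r, ‖fderiv ℝ u x‖ₑ)
          ^ ((n : ℝ) / ((n : ℝ) - 1)) := by
  have hn' : (2 : ℝ) ≤ n := by exact_mod_cast hn
  obtain ⟨C, hC, hweak⟩ := aux_weak hn x₀ r hr
  obtain ⟨φ, M, hM, hφ, hφ0, hφ1, hφM, hφd⟩ := aux_cutoff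
  refine ⟨4 * C * M, by positivity, ?_⟩
  intro u hu hsupp
  set B := Metric.ball x₀ r with hB
  set p : ℝ := (n : ℝ) / ((n : ℝ) - 1) with hp
  have hp1 : 1 ≤ p := by rw [hp, le_div_iff₀ (by linarith)]; linarith
  have hp0 : 0 < p := by linarith
  -- level sets
  let A : ℤ → Set (EuclideanSpace ℝ (Fin n)) := fun k =>
    B ∩ u ⁻¹' {s | (2 : ℝ) ^ k < |s| ∧ |s| < 2 ^ (k + 1)}
  have hAm : ∀ k, MeasurableSet (A k) := fun k =>
    (hu.continuousOn.isOpen_inter_preimage Metric.isOpen_ball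
      ((isOpen_lt continuous_const continuous_abs).inter
        (isOpen_lt continuous_abs continuous_const))).measurableSet
  have hAd : Pairwise (Function.onFun Disjoint A) := by
    have key : ∀ i j : ℤ, i < j → Disjoint (A i) (A j) := by
      intro i j hij
      rw [Set.disjoint_left]
      rintro x ⟨_, hx1, hx2⟩ ⟨_, hy1, hy2⟩
      have : (2 : ℝ) ^ (i + 1) ≤ 2 ^ j := zpow_le_zpow_right₀ (by norm_num) (by omega)
      linarith
    intro i j hij
    rcases lt_or_gt_of_ne hij with h | h
    · exact key i j h
    · exact (key j i h).symm
  -- weak estimate for each level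
  have hlevel : ∀ k : ℤ, volume (B ∩ {x | (2 : ℝ) ^ (k + 1) ≤ |u x|}) ≤
      (ENNReal.ofReal (C * M * ((2 : ℝ) ^ k)⁻¹) * ∫⁻ x in A k, ‖fderiv ℝ u x‖ₑ) ^ p := by
    intro k
    have h2k : (0 : ℝ) < 2 ^ k := by positivity
    set v : EuclideanSpace ℝ (Fin n) → ℝ := fun x => φ (((2 : ℝ) ^ k)⁻¹ * u x) with hv
    have hvc : ContDiffOn ℝ 1 v B := hφ.comp_contDiffOn (contDiffOn_const.mul hu)
    have hvs : volume (Function.support v ∩ B) * 2 ≤ volume B := by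
      refine le_trans ?_ hsupp
      gcongr
      intro x hx hux
      apply hx
      simp [hv, hux, hφ0]
    refine le_trans (measure_mono ?_) ((hweak v hvc hvs).trans ?_)
    · rintro x ⟨hx, hx2⟩
      refine ⟨hx, ?_⟩
      have : v x = 1 := by
        apply hφ1
        rw [abs_mul, abs_inv, abs_of_pos h2k, inv_mul_eq_div, le_div_iff₀ h2k]
        have h3 : (2 : ℝ) ^ (k + 1) ≤ |u x| := hx2
        rw [zpow_add_one₀ (by norm_num)] at h3
        linarith
      simp [this]
    · gcongr ?_ ^ p
      have hle : ∀ x ∈ B, ‖fderiv ℝ v x‖ₑ ≤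
          (A k).indicator (fun x => ENNReal.ofReal (M * ((2 : ℝ) ^ k)⁻¹) * ‖fderiv ℝ u x‖ₑ) x := by
        intro x hx
        have hd : HasFDerivAt u (fderiv ℝ u x) x :=
          ((hu.contDiffAt (Metric.isOpen_ball.mem_nhds hx)).differentiableAt
            (by norm_num)).hasFDerivAt
        have hφx : HasDerivAt φ (deriv φ (((2 : ℝ) ^ k)⁻¹ * u x)) (((2 : ℝ) ^ k)⁻¹ * u x) :=
          (hφ.differentiable (by norm_num) _).hasDerivAt
        have hvd : HasFDerivAt v (deriv φ (((2 : ℝ) ^ k)⁻¹ * u x) •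
            (((2 : ℝ) ^ k)⁻¹ • fderiv ℝ u x)) x :=
          hφx.comp_hasFDerivAt x (hd.const_mul (((2 : ℝ) ^ k)⁻¹))
        rw [hvd.fderiv]
        by_cases hxA : x ∈ A k
        · rw [Set.indicator_of_mem hxA, enorm_smul, enorm_smul, ← mul_assoc,
            ENNReal.ofReal_mul hM.le]
          gcongr
          · rw [← ofReal_norm]; exact ENNReal.ofReal_le_ofReal (hφM _)
          · rw [← ofReal_norm, Real.norm_of_nonneg (by positivity)]
        · rw [Set.indicator_of_notMem hxA, hφd]
          · rw [zero_smul, ← ofReal_norm, norm_zero, ENNReal.ofReal_zero]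
          · rintro ⟨h1, h2⟩
            apply hxA
            rw [abs_mul, abs_inv, abs_of_pos h2k, inv_mul_eq_div] at h1 h2
            rw [lt_div_iff₀ h2k] at h1
            rw [div_lt_iff₀ h2k] at h2
            refine ⟨hx, ?_, ?_⟩
            · linarith
            · rw [zpow_add_one₀ (by norm_num)]; linarith
      calc ENNReal.ofReal C * ∫⁻ x in B, ‖fderiv ℝ v x‖ₑ
          ≤ ENNReal.ofReal C * ∫⁻ x in B, (A k).indicator
              (fun x => ENNReal.ofReal (M * ((2 : ℝ) ^ k)⁻¹) * ‖fderiv ℝ u x‖ₑ) x := by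
            refine mul_le_mul_right ?_ _
            exact setLIntegral_mono' measurableSet_ball hle
        _ ≤ ENNReal.ofReal C * ∫⁻ x, (A k).indicator
              (fun x => ENNReal.ofReal (M * ((2 : ℝ) ^ k)⁻¹) * ‖fderiv ℝ u x‖ₑ) x := by
            refine mul_le_mul_right ?_ _
            exact setLIntegral_le_lintegral _ _
        _ = _ := by
            rw [lintegral_indicator (hAm k), lintegral_const_mul' _ _ ENNReal.ofReal_ne_top,
              ← mul_assoc, ← ENNReal.ofReal_mul hC.le, mul_assoc C M]
  -- dyadic pieces
  let D : ℤ → Set (EuclideanSpace ℝ (Fin n)) := fun k =>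
    B ∩ {x | (2 : ℝ) ^ (k + 1) ≤ |u x| ∧ |u x| < 2 ^ (k + 2)}
  set f : EuclideanSpace ℝ (Fin n) → ENNReal := fun x => ENNReal.ofReal (|u x| ^ p) with hf
  have hpiece : ∀ k : ℤ, ∫⁻ x in D k, f x ≤
      (ENNReal.ofReal (4 * C * M) * ∫⁻ x in A k, ‖fderiv ℝ u x‖ₑ) ^ p := by
    intro k
    have h2k : (0 : ℝ) < 2 ^ k := by positivity
    calc ∫⁻ x in D k, f x ≤ ∫⁻ x in D k, ENNReal.ofReal (4 * 2 ^ k) ^ p := by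
          refine setLIntegral_mono measurable_const fun x hx => ?_
          rw [hf, ENNReal.ofReal_rpow_of_nonneg (by positivity) hp0.le]
          apply ENNReal.ofReal_le_ofReal
          gcongr
          have := hx.2.2
          rw [zpow_add₀ (by norm_num)] at this
          norm_num at this
          linarith
      _ = ENNReal.ofReal (4 * 2 ^ k) ^ p * volume (D k) := by rw [setLIntegral_const]
      _ ≤ ENNReal.ofReal (4 * 2 ^ k) ^ p * (ENNReal.ofReal (C * M * ((2 : ℝ) ^ k)⁻¹) *
            ∫⁻ x in A k, ‖fderiv ℝ u x‖ₑ) ^ p := by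
          refine mul_le_mul_right ?_ _
          refine le_trans (measure_mono ?_) (hlevel k)
          exact fun x hx => ⟨hx.1, hx.2.1⟩
      _ = _ := by
          rw [← ENNReal.mul_rpow_of_nonneg _ _ hp0.le, ← mul_assoc,
            ← ENNReal.ofReal_mul (by positivity)]
          congr 3
          field_simp
  have hzero : ∀ x, u x = 0 → f x = 0 := by
    intro x hx; simp [hf, hx, Real.zero_rpow hp0.ne']
  have hcover : B ⊆ {x | u x = 0} ∪ ⋃ k, D k := by
    intro x hxB
    by_cases hx : u x = 0
    · exact Or.inl hx
    have hux : 0 < |u x| := abs_pos.2 hx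
    obtain ⟨m, hm⟩ := exists_mem_Ico_zpow hux (one_lt_two (α := ℝ))
    refine Or.inr (Set.mem_iUnion.2 ⟨m - 1, hxB, ?_, ?_⟩)
    · rw [sub_add_cancel]; exact hm.1
    · rw [show m - 1 + 2 = m + 1 by ring]; exact hm.2
  have hN : ∫⁻ x in {x | u x = 0}, f x ≤ 0 := by
    calc ∫⁻ x in {x | u x = 0}, f x ≤ ∫⁻ x in {x | u x = 0}, 0 :=
          setLIntegral_mono measurable_const fun x hx => (hzero x hx).le
      _ = 0 := by simp
  calc ∫⁻ x in B, f x ≤ ∫⁻ x in {x | u x = 0} ∪ ⋃ k, D k, f x := lintegral_mono_set hcover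
    _ ≤ (∫⁻ x in {x | u x = 0}, f x) + ∫⁻ x in ⋃ k, D k, f x := lintegral_union_le _ _ _
    _ ≤ 0 + ∫⁻ x in ⋃ k, D k, f x := add_le_add hN le_rfl
    _ = ∫⁻ x in ⋃ k, D k, f x := zero_add _
    _ ≤ ∑' k, ∫⁻ x in D k, f x := lintegral_iUnion_le _ _
    _ ≤ ∑' k, (ENNReal.ofReal (4 * C * M) * ∫⁻ x in A k, ‖fderiv ℝ u x‖ₑ) ^ p :=
        ENNReal.tsum_le_tsum hpiece
    _ ≤ (∑' k, ENNReal.ofReal (4 * C * M) * ∫⁻ x in A k, ‖fderiv ℝ u x‖ₑ) ^ p :=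
        aux_tsum _ _ hp1
    _ = (ENNReal.ofReal (4 * C * M) * ∫⁻ x in ⋃ k, A k, ‖fderiv ℝ u x‖ₑ) ^ p := by
        rw [ENNReal.tsum_mul_left, lintegral_iUnion hAm hAd]
    _ ≤ _ := by
        gcongr
        exact Set.iUnion_subset fun k => Set.inter_subset_left

/-- Let `n ≥ 2` and let `B` be an open ball in `ℝⁿ`. There is a constant
`C = C(B)` such that for every `C¹` function `u : B → ℝ` with gradient integrable on `B`
and with `support(u) ∩ B` of Lebesgue measure at most half that of `B`,
`∫_B |u|^{n/(n−1)} ≤ C·(∫_B |∇u|)^{n/(n−1)}`. -/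
theorem sobolev_poincare_on_ball
    (n : ℕ) (hn : 2 ≤ n) (x₀ : EuclideanSpace ℝ (Fin n)) (r : ℝ) (hr : 0 < r) :
    ∃ C > 0, ∀ u : EuclideanSpace ℝ (Fin n) → ℝ,
      ContDiffOn ℝ 1 u (Metric.ball x₀ r) →
      IntegrableOn (fun x => ‖fderiv ℝ u x‖) (Metric.ball x₀ r) volume →
      volume (Function.support u ∩ Metric.ball x₀ r) * 2 ≤ volume (Metric.ball x₀ r) →
      (∫ x in Metric.ball x₀ r, |u x| ^ ((n : ℝ) / ((n : ℝ) - 1)))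
        ≤ C * (∫ x in Metric.ball x₀ r, ‖fderiv ℝ u x‖) ^ ((n : ℝ) / ((n : ℝ) - 1)) := by
  have hn' : (2 : ℝ) ≤ n := by exact_mod_cast hn
  obtain ⟨C, hC, hmain⟩ := aux_main hn x₀ r hr
  have hp0 : 0 < (n : ℝ) / ((n : ℝ) - 1) := div_pos (by linarith) (by linarith)
  refine ⟨C ^ ((n : ℝ) / ((n : ℝ) - 1)), by positivity, ?_⟩
  intro u hu hint hsupp
  have h := hmain u hu hsupp
  have hI : ENNReal.ofReal (∫ x in Metric.ball x₀ r, ‖fderiv ℝ u x‖)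
      = ∫⁻ x in Metric.ball x₀ r, ‖fderiv ℝ u x‖ₑ := by
    have := ofReal_integral_norm_eq_lintegral_enorm hint
    simpa using this
  have hI0 : 0 ≤ ∫ x in Metric.ball x₀ r, ‖fderiv ℝ u x‖ :=
    integral_nonneg fun x => norm_nonneg _
  rw [← hI, ← ENNReal.ofReal_mul hC.le, ENNReal.ofReal_rpow_of_nonneg (by positivity) hp0.le,
    Real.mul_rpow hC.le hI0] at h
  rw [integral_eq_lintegral_of_nonneg_ae (Filter.Eventually.of_forall fun x => by positivity)]
  · exact ENNReal.toReal_le_of_le_ofReal (by positivity) h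
  · refine ContinuousOn.aestronglyMeasurable ?_ measurableSet_ball
    exact hu.continuousOn.abs.rpow_const fun x _ => Or.inr hp0.le
end

section
/- Let B ⊂ ℝ³ be an open ball and Λ > 0. There exist constants C > 0 and ε₀ > 0 (depending on B and Λ) such that for every ε ∈ (0, ε₀) and every C¹ function u: B → ℝ satisfying (i) ∫_B ( (ε/2)|∇u|² + (1/(2ε))(u² − 1)² ) dx ≤ Λ·ε², and (ii) the Lebesgue measure of {x ∈ B : u(x) < 0} is at most Λ·ε^{1/2} and at most half the measure of B, one has ∫_B (u − 1)² dx ≤ C·ε³. -/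
open MeasureTheory Real

lemma aux_scale (g : EuclideanSpace ℝ (Fin 3) → ENNReal) (hg : Measurable g) (t : ℝ) (ht : 0 < t)
    (z : EuclideanSpace ℝ (Fin 3)) :
    ∫⁻ y, g (z + t • y) = ENNReal.ofReal ((t ^ 3)⁻¹) * ∫⁻ y, g y := by
  have h1 : ∫⁻ y, g (z + t • y) = ∫⁻ y, g (z + y) ∂(Measure.map (fun y => t • y) volume) := by
    rw [lintegral_map (by fun_prop) (by fun_prop)]
  rw [h1, Measure.map_addHaar_smul _ ht.ne', lintegral_smul_measure, lintegral_add_left_eq_self]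
  simp [abs_of_pos ht]

lemma aux_J (g : EuclideanSpace ℝ (Fin 3) → ENNReal) (hg : Measurable g)
    (E S : Set (EuclideanSpace ℝ (Fin 3))) (t : ℝ) (ht : 0 < t) :
    ∫⁻ x in E, ∫⁻ y in S, g ((1 - t) • x + t • y)
      ≤ ENNReal.ofReal ((t ^ 3)⁻¹) * (∫⁻ y, g y) * volume E := by
  rw [← setLIntegral_const]
  refine lintegral_mono fun x => ?_
  rw [← aux_scale g hg t ht ((1 - t) • x)]
  exact setLIntegral_le_lintegral _ _

lemma aux_J' (g : EuclideanSpace ℝ (Fin 3) → ENNReal) (hg : Measurable g)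
    (E S : Set (EuclideanSpace ℝ (Fin 3))) (t : ℝ) (ht : t < 1) :
    ∫⁻ x in E, ∫⁻ y in S, g ((1 - t) • x + t • y)
      ≤ ENNReal.ofReal (((1 - t) ^ 3)⁻¹) * (∫⁻ y, g y) * volume S := by
  rw [lintegral_lintegral_swap (by fun_prop)]
  have := aux_J g hg S E (1 - t) (by linarith)
  refine le_trans (le_of_eq ?_) this
  simp only [sub_sub_cancel, add_comm]

lemma aux_inv (τ : ℝ) (h0 : 0 < τ) (h1 : τ ≤ 1) :
    ∫⁻ t in Set.Ioc τ 1, ENNReal.ofReal ((t ^ 3)⁻¹) ≤ ENNReal.ofReal (1 / (2 * τ ^ 2)) := by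
  have hc : ContinuousOn (fun t : ℝ => (t ^ 3)⁻¹) (Set.Icc τ 1) := by
    apply ContinuousOn.inv₀ (by fun_prop)
    intro t ht
    have : 0 < t := h0.trans_le ht.1
    positivity
  have hI : ∫ t in τ..1, (t ^ 3)⁻¹ = -(1 / 2) * ((1 : ℝ) ^ 2)⁻¹ - -(1 / 2) * (τ ^ 2)⁻¹ := by
    apply intervalIntegral.integral_eq_sub_of_hasDerivAt (f := fun t : ℝ => -(1 / 2) * (t ^ 2)⁻¹)
    · intro t ht
      rw [Set.uIcc_of_le h1] at ht
      have : 0 < t := h0.trans_le ht.1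
      have h := ((hasDerivAt_pow 2 t).fun_inv (by positivity)).const_mul (-(1 / 2))
      refine h.congr_deriv ?_
      have := this.ne'
      push_cast
      field_simp
    · apply ContinuousOn.intervalIntegrable
      rwa [Set.uIcc_of_le h1]
  rw [← ofReal_integral_eq_lintegral_ofReal]
  · rw [← intervalIntegral.integral_of_le h1, hI]
    apply ENNReal.ofReal_le_ofReal
    have : 0 < τ ^ 2 := by positivity
    rw [show 1 / (2 * τ ^ 2) = (1 / 2) * (τ ^ 2)⁻¹ by field_simp]
    norm_num
  · exact (hc.integrableOn_Icc).mono_set Set.Ioc_subset_Icc_self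
  · rw [Filter.EventuallyLE, ae_restrict_iff' measurableSet_Ioc]
    refine Filter.Eventually.of_forall fun t ht => ?_
    have : 0 < t := h0.trans ht.1
    simp only [Pi.zero_apply]
    positivity

lemma aux_total (g : EuclideanSpace ℝ (Fin 3) → ENNReal) (hg : Measurable g)
    (E S : Set (EuclideanSpace ℝ (Fin 3))) (τ : ℝ) (h0 : 0 < τ) (h1 : τ ≤ 1 / 2) :
    ∫⁻ x in E, ∫⁻ y in S, ∫⁻ t in Set.Ioc (0 : ℝ) 1, g ((1 - t) • x + t • y)
      ≤ ENNReal.ofReal (8 * τ) * (∫⁻ y, g y) * volume S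
        + ENNReal.ofReal (1 / (2 * τ ^ 2)) * (∫⁻ y, g y) * volume E := by
  have hsw : ∫⁻ x in E, ∫⁻ y in S, ∫⁻ t in Set.Ioc (0 : ℝ) 1, g ((1 - t) • x + t • y)
      = ∫⁻ t in Set.Ioc (0 : ℝ) 1, ∫⁻ x in E, ∫⁻ y in S, g ((1 - t) • x + t • y) := by
    rw [lintegral_lintegral_swap (μ := volume.restrict (Set.Ioc (0:ℝ) 1))]
    · refine lintegral_congr fun x => ?_
      rw [lintegral_lintegral_swap (by fun_prop)]
    · apply Measurable.aemeasurable
      apply Measurable.lintegral_prod_right'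
        (f := fun p : (ℝ × EuclideanSpace ℝ (Fin 3)) × EuclideanSpace ℝ (Fin 3) =>
          g ((1 - p.1.1) • p.1.2 + p.1.1 • p.2))
      fun_prop
  rw [hsw, ← Set.Ioc_union_Ioc_eq_Ioc h0.le (by linarith : τ ≤ 1)]
  refine (lintegral_union_le _ _ _).trans (add_le_add ?_ ?_)
  · calc _ ≤ ∫⁻ t in Set.Ioc 0 τ, ENNReal.ofReal 8 * (∫⁻ y, g y) * volume S := by
          refine setLIntegral_mono measurable_const fun t ht => ?_
          refine (aux_J' g hg E S t (by linarith [ht.2])).trans ?_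
          gcongr
          have h2 : (1 / 2 : ℝ) ≤ 1 - t := by linarith [ht.2]
          have h3 : (1 / 2 : ℝ) ^ 3 ≤ (1 - t) ^ 3 := by gcongr
          rw [inv_le_comm₀ (by positivity) (by norm_num)]
          linarith
      _ = _ := by
          rw [setLIntegral_const, Real.volume_Ioc, sub_zero, ENNReal.ofReal_mul (by norm_num)]
          ring
  · calc _ ≤ ∫⁻ t in Set.Ioc τ 1, ENNReal.ofReal ((t ^ 3)⁻¹) * ((∫⁻ y, g y) * volume E) := by
          refine setLIntegral_mono (by fun_prop) fun t ht => ?_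
          refine (aux_J g hg E S t (h0.trans ht.1)).trans ?_
          rw [mul_assoc]
      _ ≤ _ := by
          rw [lintegral_mul_const _ (by fun_prop), mul_assoc]
          gcongr
          exact aux_inv τ h0 (by linarith)

lemma aux_Phi : ∃ Φ : ℝ → ℝ, (∀ s, HasDerivAt Φ (max 0 (1 - s ^ 2)) s) ∧
    (∀ s t, s < 0 → 1 / 2 ≤ t → 3 / 8 ≤ Φ t - Φ s) := by
  have hc : Continuous fun s : ℝ => max 0 (1 - s ^ 2) := by fun_prop
  have hd : ∀ s, HasDerivAt (fun v => ∫ x in (0 : ℝ)..v, max 0 (1 - x ^ 2)) (max 0 (1 - s ^ 2)) s :=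
    fun s => (hc.integral_hasStrictDerivAt 0 s).hasDerivAt
  refine ⟨_, hd, ?_⟩
  intro s t hs ht
  have hii : ∀ a b, IntervalIntegrable (fun s : ℝ => max 0 (1 - s ^ 2)) volume a b :=
    fun a b => hc.intervalIntegrable a b
  rw [intervalIntegral.integral_interval_sub_left (hii _ _) (hii _ _)]
  rw [← intervalIntegral.integral_add_adjacent_intervals (hii s 0) (hii 0 t),
    ← intervalIntegral.integral_add_adjacent_intervals (hii 0 (1/2)) (hii (1/2) t)]
  have e1 : 0 ≤ ∫ x in s..0, max 0 (1 - x ^ 2) :=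
    intervalIntegral.integral_nonneg hs.le fun x _ => le_max_left _ _
  have e2 : 0 ≤ ∫ x in (1/2)..t, max 0 (1 - x ^ 2) :=
    intervalIntegral.integral_nonneg ht fun x _ => le_max_left _ _
  have e3 : ∫ x in (0:ℝ)..(1/2), (3 / 4 : ℝ) ≤ ∫ x in (0:ℝ)..(1/2), max 0 (1 - x ^ 2) := by
    apply intervalIntegral.integral_mono_on (by norm_num) (by simp) (hii _ _)
    intro x hx
    refine le_max_of_le_right ?_
    nlinarith [hx.1, hx.2]
  rw [intervalIntegral.integral_const] at e3
  norm_num at e3 ⊢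
  linarith

lemma aux_seg (x₀ : EuclideanSpace ℝ (Fin 3)) (r : ℝ) (hr : 0 < r) (ε : ℝ) (hε : 0 < ε)
    (u : EuclideanSpace ℝ (Fin 3) → ℝ) (hu : ContDiffOn ℝ 1 u (Metric.ball x₀ r))
    (x y : EuclideanSpace ℝ (Fin 3)) (hx : x ∈ Metric.ball x₀ r) (hy : y ∈ Metric.ball x₀ r)
    (hux : u x < 0) (huy : 1 / 2 ≤ u y) :
    ENNReal.ofReal (3 / 8) ≤ ENNReal.ofReal (2 * r) * ∫⁻ t in Set.Ioc (0 : ℝ) 1,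
      (Metric.ball x₀ r).indicator (fun x => ENNReal.ofReal ((ε / 2) * ‖fderiv ℝ u x‖ ^ 2
            + (1 / (2 * ε)) * ((u x) ^ 2 - 1) ^ 2)) ((1 - t) • x + t • y) := by
  obtain ⟨Φ, hΦ, hΦ2⟩ := aux_Phi
  have hγ : ∀ t ∈ Set.Icc (0 : ℝ) 1, (1 - t) • x + t • y ∈ Metric.ball x₀ r := fun t ht =>
    convex_ball x₀ r hx hy (by linarith [ht.2]) ht.1 (by ring)
  have hud : ∀ z ∈ Metric.ball x₀ r, HasFDerivAt u (fderiv ℝ u z) z := fun z hz =>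
    ((hu.differentiableOn one_ne_zero).differentiableAt
      (Metric.isOpen_ball.mem_nhds hz)).hasFDerivAt
  have hfc : ContinuousOn (fderiv ℝ u) (Metric.ball x₀ r) :=
    hu.continuousOn_fderiv_of_isOpen Metric.isOpen_ball le_rfl
  have hγd : ∀ t : ℝ, HasDerivAt (fun t : ℝ => (1 - t) • x + t • y) (y - x) t := by
    intro t
    have h1 := ((hasDerivAt_id t).const_sub 1).smul_const x
    have h2 := (hasDerivAt_id t).smul_const y
    refine (h1.add h2).congr_deriv ?_
    rw [neg_one_smul, one_smul]
    abel
  have hγc : Continuous (fun t : ℝ => (1 - t) • x + t • y) := by fun_prop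
  set γ := fun t : ℝ => (1 - t) • x + t • y with hγdef
  have hder : ∀ t ∈ Set.uIcc (0 : ℝ) 1, HasDerivAt (fun t => Φ (u (γ t)))
      (max 0 (1 - (u (γ t)) ^ 2) * (fderiv ℝ u (γ t) (y - x))) t := by
    intro t ht
    rw [Set.uIcc_of_le zero_le_one] at ht
    have h1 : HasDerivAt (fun t => u (γ t)) (fderiv ℝ u (γ t) (y - x)) t :=
      (hud _ (hγ t ht)).comp_hasDerivAt t (hγd t)
    exact (hΦ (u (γ t))).comp t h1
  have hmaps : Set.MapsTo γ (Set.uIcc 0 1) (Metric.ball x₀ r) := by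
    intro t ht
    rw [Set.uIcc_of_le zero_le_one] at ht
    exact hγ t ht
  have hint : IntervalIntegrable (fun t => max 0 (1 - (u (γ t)) ^ 2) * (fderiv ℝ u (γ t) (y - x)))
      volume 0 1 := by
    apply ContinuousOn.intervalIntegrable
    have hc1 : ContinuousOn (fun t => u (γ t)) (Set.uIcc 0 1) :=
      hu.continuousOn.comp hγc.continuousOn hmaps
    have hc2 : ContinuousOn (fun t => fderiv ℝ u (γ t)) (Set.uIcc 0 1) :=
      hfc.comp hγc.continuousOn hmaps
    exact (ContinuousOn.sup continuousOn_const (continuousOn_const.sub (hc1.pow 2))).mul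
      (hc2.clm_apply continuousOn_const)
  have hFTC := intervalIntegral.integral_eq_sub_of_hasDerivAt hder hint
  have hge : 3 / 8 ≤ ∫ t in (0:ℝ)..1, max 0 (1 - (u (γ t)) ^ 2) * (fderiv ℝ u (γ t) (y - x)) := by
    rw [hFTC]
    have e0 : γ 0 = x := by simp [hγdef]
    have e1 : γ 1 = y := by simp [hγdef]
    rw [e0, e1]
    exact hΦ2 _ _ hux huy
  rw [intervalIntegral.integral_of_le zero_le_one] at hge
  rw [← lintegral_const_mul' _ _ ENNReal.ofReal_ne_top]
  refine (ENNReal.ofReal_le_ofReal (hge.trans (le_abs_self _))).trans ?_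
  rw [← Real.norm_eq_abs, ofReal_norm]
  refine (enorm_integral_le_lintegral_enorm _).trans ?_
  apply setLIntegral_mono' measurableSet_Ioc
  intro t ht
  have hb := hγ t ⟨ht.1.le, ht.2⟩
  rw [Set.indicator_of_mem hb, ← ENNReal.ofReal_mul (by positivity), ← ofReal_norm]
  apply ENNReal.ofReal_le_ofReal
  rw [norm_mul]
  have hxy : ‖y - x‖ ≤ 2 * r := by
    rw [← dist_eq_norm]
    have := dist_triangle_right y x x₀
    rw [Metric.mem_ball] at hx hy
    linarith
  have hop := (fderiv ℝ u (γ t)).le_opNorm (y - x)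
  have hm : ‖max 0 (1 - (u (γ t)) ^ 2)‖ ≤ |u (γ t) ^ 2 - 1| := by
    rw [Real.norm_of_nonneg (le_max_left _ _), abs_sub_comm]
    exact max_le (abs_nonneg _) (le_abs_self _)
  have hyoung : |u (γ t) ^ 2 - 1| * ‖fderiv ℝ u (γ t)‖ ≤ (ε / 2) * ‖fderiv ℝ u (γ t)‖ ^ 2
            + (1 / (2 * ε)) * ((u (γ t)) ^ 2 - 1) ^ 2 := by
    rw [← sq_abs (u (γ t) ^ 2 - 1)]
    generalize |u (γ t) ^ 2 - 1| = b
    generalize ‖fderiv ℝ u (γ t)‖ = a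
    have : (ε / 2) * a ^ 2 + (1 / (2 * ε)) * b ^ 2 - b * a = (ε * a - b) ^ 2 / (2 * ε) := by
      field_simp
      ring
    have h2 : 0 ≤ (ε * a - b) ^ 2 / (2 * ε) := by positivity
    linarith
  calc _ ≤ |u (γ t) ^ 2 - 1| * (‖fderiv ℝ u (γ t)‖ * (2 * r)) := by
        gcongr
        exact hop.trans (by gcongr)
    _ = (2 * r) * (|u (γ t) ^ 2 - 1| * ‖fderiv ℝ u (γ t)‖) := by ring
    _ ≤ _ := by gcongr

/-- Let `B ⊂ ℝ³` be an open ball and `Λ > 0`. There are `C, ε₀ > 0`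
(depending on `B` and `Λ`) such that for every `ε ∈ (0, ε₀)` and every `C¹` function
`u : B → ℝ` with (i) `∫_B ((ε/2)|∇u|² + (1/(2ε))(u²−1)²) ≤ Λ·ε²`, and (ii) the measure of
`{x ∈ B : u(x) < 0}` at most `Λ·ε^{1/2}` and at most half the measure of `B`, one has
`∫_B (u − 1)² ≤ C·ε³`. -/
theorem small_energy_implies_L2_close_to_one
    (x₀ : EuclideanSpace ℝ (Fin 3)) (r : ℝ) (hr : 0 < r) (Λ : ℝ) (hΛ : 0 < Λ) :
    ∃ C > 0, ∃ ε₀ > 0, ∀ ε : ℝ, ε ∈ Set.Ioo (0 : ℝ) ε₀ →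
      ∀ u : EuclideanSpace ℝ (Fin 3) → ℝ,
        ContDiffOn ℝ 1 u (Metric.ball x₀ r) →
        IntegrableOn (fun x => (ε / 2) * ‖fderiv ℝ u x‖ ^ 2
            + (1 / (2 * ε)) * ((u x) ^ 2 - 1) ^ 2) (Metric.ball x₀ r) volume →
        (∫ x in Metric.ball x₀ r,
            ((ε / 2) * ‖fderiv ℝ u x‖ ^ 2 + (1 / (2 * ε)) * ((u x) ^ 2 - 1) ^ 2))
          ≤ Λ * ε ^ 2 →
        volume {x ∈ Metric.ball x₀ r | u x < 0} ≤ ENNReal.ofReal (Λ * Real.sqrt ε) →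
        volume {x ∈ Metric.ball x₀ r | u x < 0} * 2 ≤ volume (Metric.ball x₀ r) →
        (∫ x in Metric.ball x₀ r, (u x - 1) ^ 2) ≤ C * ε ^ 3 := by
  set B := Metric.ball x₀ r with hB
  set V := volume.real B with hV
  have hBtop : volume B ≠ ⊤ := measure_ball_lt_top.ne
  have hVpos : 0 < V := ENNReal.toReal_pos (Metric.measure_ball_pos volume x₀ hr).ne' hBtop
  set K := Real.sqrt (128 * r * Λ / V) with hK
  refine ⟨4 * Λ + 8 * (V * K ^ 3), by positivity, min 1 (V / (16 * Λ)), by positivity, ?_⟩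
  intro ε hε u hu hint hen _ hhalf
  have hε0 : 0 < ε := hε.1
  have hε1 : ε < 1 := hε.2.trans_le (min_le_left _ _)
  have hε2 : ε < V / (16 * Λ) := hε.2.trans_le (min_le_right _ _)
  set e := fun x => (ε / 2) * ‖fderiv ℝ u x‖ ^ 2 + (1 / (2 * ε)) * ((u x) ^ 2 - 1) ^ 2 with he
  have he0 : ∀ x, 0 ≤ e x := fun x => by simp only [he]; positivity
  have hee : ∀ x, ((u x) ^ 2 - 1) ^ 2 ≤ 2 * ε * e x := fun x => by
    have : 2 * ε * e x = ε ^ 2 * ‖fderiv ℝ u x‖ ^ 2 + ((u x) ^ 2 - 1) ^ 2 := by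
      simp only [he]; field_simp
    rw [this]
    have : 0 ≤ ε ^ 2 * ‖fderiv ℝ u x‖ ^ 2 := by positivity
    linarith
  set E := {x ∈ B | u x < 0} with hE
  set S := {x ∈ B | 1 / 2 ≤ u x} with hS
  set M := {x ∈ B | 0 ≤ u x ∧ u x < 1 / 2} with hM
  have hBo : IsOpen B := Metric.isOpen_ball
  have hlt : ∀ c : ℝ, MeasurableSet {x ∈ B | u x < c} := fun c =>
    (hu.continuousOn.isOpen_inter_preimage hBo isOpen_Iio).measurableSet
  have hEm : MeasurableSet E := hlt 0
  have hSm : MeasurableSet S := by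
    have : S = B \ {x ∈ B | u x < 1 / 2} := by
      ext x; simp only [hS, Set.mem_sdiff, Set.mem_ofPred_eq, not_and, not_lt]; tauto
    rw [this]; exact hBo.measurableSet.diff (hlt _)
  have hMm : MeasurableSet M := by
    have : M = {x ∈ B | u x < 1 / 2} \ E := by
      ext x; simp only [hM, hE, Set.mem_sdiff, Set.mem_ofPred_eq, not_and, not_lt]; tauto
    rw [this]; exact (hlt _).diff hEm
  have hEB : E ⊆ B := fun x hx => hx.1
  have hSB : S ⊆ B := fun x hx => hx.1
  have hMB : M ⊆ B := fun x hx => hx.1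
  have hfin : ∀ {A}, A ⊆ B → volume A ≠ ⊤ := fun h => measure_ne_top_of_subset h hBtop
  -- the half condition
  have hhalf' : volume.real E * 2 ≤ V := by
    have := ENNReal.toReal_mono hBtop hhalf
    rwa [ENNReal.toReal_mul] at this
  -- the middle set is small
  have hMs : volume.real M ≤ 4 * Λ * ε ^ 3 := by
    have h1 : ∫ x in M, (9 / 16 : ℝ) ≤ ∫ x in M, 2 * ε * e x := by
      apply setIntegral_mono_on (integrableOn_const (hfin hMB))
        ((hint.mono_set hMB).const_mul (2 * ε)) hMm
      intro x hx
      refine le_trans ?_ (hee x)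
      have h1 : u x ^ 2 ≤ 1 / 4 := by nlinarith [hx.2.1, hx.2.2]
      nlinarith
    have h2 : ∫ x in M, 2 * ε * e x ≤ ∫ x in B, 2 * ε * e x := by
      apply setIntegral_mono_set (hint.const_mul (2 * ε))
      · exact Filter.Eventually.of_forall fun x => by
          have := he0 x
          simp only [Pi.zero_apply]; positivity
      · exact hMB.eventuallyLE
    rw [integral_const_mul, integral_const_mul] at h2
    rw [setIntegral_const, smul_eq_mul, integral_const_mul] at h1
    have h3 : 2 * ε * ∫ x in B, e x ≤ 2 * ε * (Λ * ε ^ 2) := by gcongr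
    have h4 : 0 < Λ * ε ^ 3 := by positivity
    nlinarith
  have hcover : V ≤ volume.real E + volume.real M + volume.real S := by
    have h1 : B ⊆ (E ∪ M) ∪ S := by
      intro x hx
      by_cases h1 : u x < 0
      · exact Or.inl (Or.inl ⟨hx, h1⟩)
      · by_cases h2 : u x < 1 / 2
        · exact Or.inl (Or.inr ⟨hx, not_lt.1 h1, h2⟩)
        · exact Or.inr ⟨hx, not_lt.1 h2⟩
    have h2 := measureReal_mono h1 (μ := volume)
      (hfin (Set.union_subset (Set.union_subset hEB hMB) hSB))
    have h3 := measureReal_union_le (μ := volume) (E ∪ M) S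
    have h4 := measureReal_union_le (μ := volume) E M
    linarith
  have hSs : V / 4 ≤ volume.real S := by
    have h1 : ε ^ 3 ≤ ε := by
      have : ε ^ 2 ≤ 1 := by nlinarith
      nlinarith
    have h2 : ε * (16 * Λ) < V := by rwa [lt_div_iff₀ (by positivity)] at hε2
    have h3 : Λ * ε ^ 3 ≤ Λ * ε := by gcongr
    nlinarith
  have hSV : volume.real S ≤ V := measureReal_mono hSB hBtop
  -- main estimate
  have hEs : volume.real E ≤ V * K ^ 3 * ε ^ 3 := by
    by_cases ha0 : volume.real E = 0
    · rw [ha0]; positivity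
    set a := volume.real E with ha
    have hapos : 0 < a := lt_of_le_of_ne measureReal_nonneg (Ne.symm ha0)
    set s := (a / V) ^ (1 / 3 : ℝ) with hs
    have hspos : 0 < s := by positivity
    have hs3 : s ^ 3 = a / V := by
      rw [hs, ← Real.rpow_natCast, ← Real.rpow_mul (by positivity)]; norm_num
    have haV : a = V * s ^ 3 := by rw [hs3]; field_simp
    have hs1 : s ≤ 1 := by
      apply Real.rpow_le_one (by positivity) _ (by norm_num)
      rw [div_le_one hVpos]; linarith
    set g := B.indicator (fun x => ENNReal.ofReal (e x)) with hg
    have hfc : ContinuousOn (fderiv ℝ u) B := hu.continuousOn_fderiv_of_isOpen hBo le_rfl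
    have hec : ContinuousOn (fun x => ENNReal.ofReal (e x)) B := by
      apply ENNReal.continuous_ofReal.comp_continuousOn
      have := hu.continuousOn
      simp only [he]
      fun_prop
    have hgm : Measurable g := by
      classical
      rw [hg, ← Set.piecewise_eq_indicator]
      exact hec.measurable_piecewise continuousOn_const hBo.measurableSet
    have hG : ∫⁻ y, g y ≤ ENNReal.ofReal (Λ * ε ^ 2) := by
      rw [hg, lintegral_indicator hBo.measurableSet,
        ← ofReal_integral_eq_lintegral_ofReal hint (Filter.Eventually.of_forall he0)]
      exact ENNReal.ofReal_le_ofReal hen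
    have key : ENNReal.ofReal (3 / 8) * volume S * volume E ≤ ENNReal.ofReal (2 * r) *
        ∫⁻ x in E, ∫⁻ y in S, ∫⁻ t in Set.Ioc (0 : ℝ) 1, g ((1 - t) • x + t • y) := by
      rw [← lintegral_const_mul' _ _ ENNReal.ofReal_ne_top, ← setLIntegral_const]
      refine setLIntegral_mono' hEm fun x hx => ?_
      rw [← lintegral_const_mul' _ _ ENNReal.ofReal_ne_top, ← setLIntegral_const]
      refine setLIntegral_mono' hSm fun y hy => ?_
      exact aux_seg x₀ r hr ε hε0 u hu x y hx.1 hy.1 hx.2 hy.2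
    have key2 := aux_total g hgm E S (s / 2) (by positivity) (by linarith)
    have key3 : ENNReal.ofReal (3 / 8 * volume.real S * a) ≤
        ENNReal.ofReal (2 * r * (8 * (s / 2) * (Λ * ε ^ 2) * volume.real S
          + 1 / (2 * (s / 2) ^ 2) * (Λ * ε ^ 2) * a)) := by
      rw [ENNReal.ofReal_mul (by positivity), ENNReal.ofReal_mul (by positivity),
        ENNReal.ofReal_mul (by positivity), ENNReal.ofReal_add (by positivity) (by positivity),
        ENNReal.ofReal_mul (q := volume.real S) (by positivity),
        ENNReal.ofReal_mul (q := Λ * ε ^ 2) (by positivity),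
        ENNReal.ofReal_mul (q := a) (by positivity),
        ENNReal.ofReal_mul (q := Λ * ε ^ 2) (by positivity),
        ha, ofReal_measureReal (hfin hSB), ofReal_measureReal (hfin hEB)]
      refine key.trans ?_
      gcongr
      refine key2.trans ?_
      gcongr
    rw [ENNReal.ofReal_le_ofReal_iff (by positivity)] at key3
    have k4 : 3 / 8 * (V / 4) * a ≤ 2 * r * (8 * (s / 2) * (Λ * ε ^ 2) * V
          + 1 / (2 * (s / 2) ^ 2) * (Λ * ε ^ 2) * a) := by
      refine le_trans ?_ (key3.trans ?_)
      · gcongr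
      · gcongr
    have k5 : 1 / (2 * (s / 2) ^ 2) * (Λ * ε ^ 2) * a = 2 * s * V * (Λ * ε ^ 2) := by
      rw [haV]; field_simp
      try ring
    rw [k5, haV] at k4
    have k6 : (V * s) * (V * s ^ 2) ≤ (V * s) * (128 * r * (Λ * ε ^ 2)) := by
      nlinarith
    have k7 := le_of_mul_le_mul_left k6 (by positivity)
    have k8 : s ^ 2 ≤ (K * ε) ^ 2 := by
      rw [mul_pow, hK, Real.sq_sqrt (by positivity), div_mul_eq_mul_div, le_div_iff₀ hVpos]
      linarith
    have k9 : s ≤ K * ε := le_of_sq_le_sq k8 (by positivity)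
    rw [haV, mul_assoc, ← mul_pow]
    gcongr
  -- conclusion
  have hEi : IntegrableOn (E.indicator fun _ => (8 : ℝ)) B :=
    (integrableOn_const hBtop).indicator hEm
  calc ∫ x in B, (u x - 1) ^ 2
      ≤ ∫ x in B, (4 * ε * e x + E.indicator (fun _ => (8 : ℝ)) x) := by
        apply integral_mono_of_nonneg
        · exact Filter.Eventually.of_forall fun x => sq_nonneg _
        · exact (hint.const_mul (4 * ε)).add hEi
        · rw [Filter.EventuallyLE, ae_restrict_iff' hBo.measurableSet]
          refine Filter.Eventually.of_forall fun x hx => ?_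
          have h1 := hee x
          have h2 : (u x ^ 2 - 1) ^ 2 = (u x - 1) ^ 2 * (u x + 1) ^ 2 := by ring
          by_cases hux : u x < 0
          · rw [Set.indicator_of_mem (show x ∈ E from ⟨hx, hux⟩)]
            have h3 : (u x + 1) ^ 2 ≤ (u x ^ 2 - 1) ^ 2 := by
              rw [h2]
              exact le_mul_of_one_le_left (sq_nonneg _) (by nlinarith)
            nlinarith [sq_nonneg (u x + 3)]
          · rw [Set.indicator_of_notMem (fun h : x ∈ E => hux h.2)]
            have h3 : (u x - 1) ^ 2 ≤ (u x ^ 2 - 1) ^ 2 := by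
              rw [h2]
              exact le_mul_of_one_le_right (sq_nonneg _) (by nlinarith)
            nlinarith [sq_nonneg (u x ^ 2 - 1)]
    _ = 4 * ε * (∫ x in B, e x) + 8 * volume.real E := by
        rw [integral_add (hint.const_mul (4 * ε)) hEi, integral_const_mul,
          setIntegral_indicator hEm, Set.inter_eq_right.2 hEB, setIntegral_const, smul_eq_mul]
        ring
    _ ≤ 4 * ε * (Λ * ε ^ 2) + 8 * (V * K ^ 3 * ε ^ 3) := by gcongr
    _ = _ := by ring
end
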